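/- For every family (U_X)_{X ∈ 𝒳} with U_X an ultrafilter on 𝒞_X for every finite X ⊆ V and f_{X',X}(U_{X'}) = U_X whenever X ⊆ X', there exists a unique ℵ₀-tangle τ of G such that U(τ,X) = U_X for all X ∈ 𝒳. Consequently, the map τ ↦ (U(τ,X))_{X ∈ 𝒳} is a bijection from the set of ℵ₀-tangles of G onto the inverse limit of the system (𝒰_X)_{X ∈ 𝒳} with bonding maps f_{X',X}. -/

import Mathlib

open Set

variable {V : Type*}

/-- `{A,B}` is a separation of `G`: `A ∪ B = V` and no edge between `A∖B` and `B∖A`. -/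
def IsSep (G : SimpleGraph V) (A B : Set V) : Prop :=
  A ∪ B = Set.univ ∧ ∀ a ∈ A \ B, ∀ b ∈ B \ A, ¬ G.Adj a b

/-- A separation of finite order. -/
def IsFinSep (G : SimpleGraph V) (A B : Set V) : Prop :=
  IsSep G A B ∧ (A ∩ B).Finite

/-- The set `S⃗` of oriented finite-order separations of `G`, as ordered pairs. -/
def Svec (G : SimpleGraph V) : Set (Set V × Set V) :=
  {p | IsFinSep G p.1 p.2}

/-- `(A,B) ≤ (C,D)` iff `A ⊆ C` and `D ⊆ B`. -/
def sepLE (p q : Set V × Set V) : Prop :=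
  p.1 ⊆ q.1 ∧ q.2 ⊆ p.2

/-- An orientation of the set `S` of finite-order separations: a subset of `S⃗` containing
exactly one of `(A,B)`, `(B,A)` for every finite-order separation `{A,B}`. -/
def IsOrientation (G : SimpleGraph V) (O : Set (Set V × Set V)) : Prop :=
  O ⊆ Svec G ∧ ∀ A B : Set V, IsFinSep G A B → ((A, B) ∈ O ↔ (B, A) ∉ O)

/-- Consistency: no two distinct members `(B,A)`, `(C,D)` with `(A,B) < (C,D)`. -/
def Consistent (O : Set (Set V × Set V)) : Prop :=
  ∀ A B C D : Set V, (B, A) ∈ O → (C, D) ∈ O → (B, A) ≠ (C, D) →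
    ¬ (sepLE (A, B) (C, D) ∧ (A, B) ≠ (C, D))

/-- A star in `S⃗`: every two distinct elements point towards each other. -/
def IsStar (G : SimpleGraph V) (σ : Set (Set V × Set V)) : Prop :=
  σ ⊆ Svec G ∧ ∀ p ∈ σ, ∀ q ∈ σ, p ≠ q → sepLE p (q.2, q.1)

/-- Membership in `T_n`: a star of at most `n` elements whose target sides have finite
intersection. -/
def InTn (G : SimpleGraph V) (n : ℕ) (σ : Set (Set V × Set V)) : Prop :=
  IsStar G σ ∧ σ.Finite ∧ σ.ncard ≤ n ∧ (⋂ p ∈ σ, p.2).Finite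

/-- Membership in `T`: an arbitrary star whose target sides have finite intersection. -/
def InT (G : SimpleGraph V) (σ : Set (Set V × Set V)) : Prop :=
  IsStar G σ ∧ (⋂ p ∈ σ, p.2).Finite

/-- An `ℵ₀`-tangle of `G`: a consistent orientation of `S` with no subset in `T₃`. -/
def IsTangle (G : SimpleGraph V) (τ : Set (Set V × Set V)) : Prop :=
  IsOrientation G τ ∧ Consistent τ ∧ ∀ σ ⊆ τ, ¬ InTn G 3 σ

/-- A `T`-tangle of `S`: a consistent orientation of `S` with no subset in `T`. -/
def IsTTangle (G : SimpleGraph V) (τ : Set (Set V × Set V)) : Prop :=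
  IsOrientation G τ ∧ Consistent τ ∧ ∀ σ ⊆ τ, ¬ InT G σ

/-- The set `𝒞_X` of (vertex sets of) connected components of `G − X`. -/
def Comps (G : SimpleGraph V) (X : Set V) : Set (Set V) :=
  {C | ∃ c : (G.induce Xᶜ).ConnectedComponent, C = Subtype.val '' c.supp}

/-- A collection of subsets of `α` is an ultrafilter on `α`. -/
def IsUltra {α : Type*} (F : Set (Set α)) : Prop :=
  ∅ ∉ F ∧ (∀ s ∈ F, ∀ t ∈ F, s ∩ t ∈ F) ∧ (∀ s ∈ F, ∀ t : Set α, s ⊆ t → t ∈ F) ∧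
    ∀ s : Set α, s ∈ F ∨ sᶜ ∈ F

/-- A principal ultrafilter, generated by a single point. -/
def IsPrincipalUF {α : Type*} (F : Set (Set α)) : Prop :=
  ∃ a : α, F = {s | a ∈ s}

/-- `U(τ,X)`: the collection of all sets `𝒮` of components of `G − X` with
`(⋃(𝒞_X∖𝒮) ∪ X, ⋃𝒮 ∪ X) ∈ τ`. -/
def tangleUF (G : SimpleGraph V) (τ : Set (Set V × Set V)) (X : Set V) :
    Set (Set ↥(Comps G X)) :=
  {𝒮 | ((⋃ C ∈ 𝒮ᶜ, (C : Set V)) ∪ X, (⋃ C ∈ 𝒮, (C : Set V)) ∪ X) ∈ τ}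

/-- `f_{X',X}`: the pushforward of an ultrafilter on `𝒞_{X'}` along the map sending each
component of `G − X'` to the component of `G − X` containing it. -/
def pushUF (G : SimpleGraph V) (X X' : Set V) (F : Set (Set ↥(Comps G X'))) :
    Set (Set ↥(Comps G X)) :=
  {𝒮 | {C' : ↥(Comps G X') | ∃ C ∈ 𝒮, (C' : Set V) ⊆ (C : Set V)} ∈ F}

/-- A direction in `G`: a choice of a component of `G − X` for every finite `X ⊆ V`,
compatible under inclusion. -/
def IsDirection (G : SimpleGraph V) (f : Set V → Set V) : Prop :=
  (∀ X : Set V, X.Finite → f X ∈ Comps G X) ∧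
    ∀ X X' : Set V, X.Finite → X'.Finite → X ⊆ X' → f X' ⊆ f X

section Components

variable {G : SimpleGraph V} {X X' A B C D : Set V}

theorem Comps.nonempty (hC : C ∈ Comps G X) : C.Nonempty := by
  obtain ⟨c, rfl⟩ := hC
  exact c.nonempty_supp.image _

theorem Comps.notMem (hC : C ∈ Comps G X) {v : V} (hv : v ∈ C) : v ∉ X := by
  obtain ⟨c, rfl⟩ := hC
  obtain ⟨w, -, rfl⟩ := hv
  exact w.2

theorem Comps.exists_mem (G : SimpleGraph V) {v : V} (hv : v ∉ X) : ∃ C ∈ Comps G X, v ∈ C :=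
  ⟨_, ⟨(G.induce Xᶜ).connectedComponentMk ⟨v, hv⟩, rfl⟩, ⟨v, hv⟩, rfl, rfl⟩

/-- A component of `G − X` is closed under adjacency in `G − X`. -/
theorem Comps.mem_of_adj (hC : C ∈ Comps G X) {u v : V} (hu : u ∈ C) (hv : v ∉ X)
    (h : G.Adj u v) : v ∈ C := by
  obtain ⟨c, rfl⟩ := hC
  obtain ⟨w, hw, rfl⟩ := hu
  refine ⟨⟨v, hv⟩, ?_, rfl⟩
  have hadj : (G.induce Xᶜ).Adj w ⟨v, hv⟩ := h
  rw [SimpleGraph.ConnectedComponent.mem_supp_iff] at hw ⊢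
  rw [← hw]
  exact (SimpleGraph.ConnectedComponent.sound hadj.reachable).symm

/-- A component of `G − X` lies in every set that it meets and that is closed under adjacency
in `G − X`. -/
theorem Comps.subset_of_closed (hC : C ∈ Comps G X) {P : Set V}
    (hP : ∀ u ∈ P, u ∉ X → ∀ v, v ∉ X → G.Adj u v → v ∈ P) {u : V} (hu : u ∈ C) (huP : u ∈ P) :
    C ⊆ P := by
  obtain ⟨c, rfl⟩ := hC
  obtain ⟨u, huc, rfl⟩ := hu
  rintro _ ⟨v, hvc, rfl⟩
  rw [SimpleGraph.ConnectedComponent.mem_supp_iff] at huc hvc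
  obtain ⟨p⟩ := SimpleGraph.ConnectedComponent.exact (huc.trans hvc.symm)
  clear huc hvc
  induction p with
  | nil => exact huP
  | @cons a b _ hab _ ih => exact ih (hP _ huP a.2 _ b.2 hab)

theorem Comps.subset_of_mem (hXX : X ⊆ X') (hC : C ∈ Comps G X) (hD : D ∈ Comps G X') {v : V}
    (hvC : v ∈ C) (hvD : v ∈ D) : D ⊆ C :=
  Comps.subset_of_closed hD
    (fun _ hu _ _ hw h => Comps.mem_of_adj hC hu (fun hwX => hw (hXX hwX)) h) hvD hvC

theorem Comps.eq_of_mem (hC : C ∈ Comps G X) (hD : D ∈ Comps G X) {v : V}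
    (hvC : v ∈ C) (hvD : v ∈ D) : C = D :=
  (Comps.subset_of_mem subset_rfl hD hC hvD hvC).antisymm
    (Comps.subset_of_mem subset_rfl hC hD hvC hvD)

theorem IsFinSep.symm (h : IsFinSep G A B) : IsFinSep G B A :=
  ⟨⟨by rw [union_comm]; exact h.1.1, fun b hb a ha hab => h.1.2 a ha b hb hab.symm⟩,
    by rw [inter_comm]; exact h.2⟩

/-- A component of `G − X` meeting one side of a separation with separator inside `X` lies in
that side. -/
theorem IsFinSep.comp_subset (h : IsFinSep G A B) (hX : A ∩ B ⊆ X) (hC : C ∈ Comps G X) {v : V}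
    (hv : v ∈ C) (hvB : v ∈ B) : C ⊆ B := by
  refine Comps.subset_of_closed hC (fun u hu huX w hw huw => ?_) hv hvB
  by_contra hwB
  have hwA : w ∈ A := (h.1.1.symm ▸ mem_univ w : w ∈ A ∪ B).resolve_right hwB
  exact h.1.2 w ⟨hwA, hwB⟩ u ⟨hu, fun huA => huX (hX ⟨huA, hu⟩)⟩ huw.symm

theorem IsFinSep.comp_subset_left_iff (h : IsFinSep G A B) (hX : A ∩ B ⊆ X)
    (hC : C ∈ Comps G X) : C ⊆ A ↔ ¬ C ⊆ B := by
  obtain ⟨v, hv⟩ := Comps.nonempty hC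
  constructor
  · exact fun hA hB => Comps.notMem hC hv (hX ⟨hA hv, hB hv⟩)
  · intro hB
    have hvB : v ∉ B := fun hvB => hB (h.comp_subset hX hC hv hvB)
    have hvA : v ∈ A := (h.1.1.symm ▸ mem_univ v : v ∈ A ∪ B).resolve_right hvB
    exact h.symm.comp_subset (by rwa [inter_comm]) hC hv hvA

end Components

/-- The components of `G − X` contained in `B`. -/
def compsWithin (G : SimpleGraph V) (X B : Set V) : Set ↥(Comps G X) :=
  {C | (C : Set V) ⊆ B}

section Sides

variable {G : SimpleGraph V} {X A B : Set V}

theorem IsFinSep.compsWithin_left (h : IsFinSep G A B) (hX : A ∩ B ⊆ X) :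
    compsWithin G X A = (compsWithin G X B)ᶜ :=
  ext fun C => h.comp_subset_left_iff hX C.2

/-- The right side of a separation is its separator together with the components it contains. -/
theorem IsFinSep.iUnion_compsWithin (h : IsFinSep G A B) :
    (⋃ C ∈ compsWithin G (A ∩ B) B, (C : Set V)) ∪ A ∩ B = B := by
  apply Subset.antisymm
  · exact union_subset (iUnion₂_subset fun C hC => hC) inter_subset_right
  · intro v hv
    by_cases hvX : v ∈ A ∩ B
    · exact Or.inr hvX
    · obtain ⟨C, hC, hvC⟩ := Comps.exists_mem G hvX
      exact Or.inl (mem_iUnion₂.2 ⟨⟨C, hC⟩, h.comp_subset subset_rfl hC hvC hv, hvC⟩)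

theorem IsFinSep.iUnion_compl_compsWithin (h : IsFinSep G A B) :
    (⋃ C ∈ (compsWithin G (A ∩ B) B)ᶜ, (C : Set V)) ∪ A ∩ B = A := by
  rw [← h.compsWithin_left subset_rfl]
  have := h.symm.iUnion_compsWithin
  rwa [inter_comm B A] at this

theorem mem_iUnion_comps_iff {𝒮 : Set ↥(Comps G X)} (D : ↥(Comps G X)) {v : V}
    (hv : v ∈ (D : Set V)) : v ∈ (⋃ C ∈ 𝒮, (C : Set V)) ∪ X ↔ D ∈ 𝒮 := by
  constructor
  · rintro (h | h)
    · obtain ⟨C, hC, hvC⟩ := mem_iUnion₂.1 h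
      rwa [Subtype.ext (Comps.eq_of_mem D.2 C.2 hv hvC)]
    · exact absurd h (Comps.notMem D.2 hv)
  · exact fun h => Or.inl (mem_iUnion₂.2 ⟨D, h, hv⟩)

theorem compsWithin_iUnion (𝒮 : Set ↥(Comps G X)) :
    compsWithin G X ((⋃ C ∈ 𝒮, (C : Set V)) ∪ X) = 𝒮 := by
  ext D
  obtain ⟨v, hv⟩ := Comps.nonempty D.2
  exact ⟨fun h => (mem_iUnion_comps_iff D hv).1 (h hv),
    fun h w hw => (mem_iUnion_comps_iff D hw).2 h⟩

theorem iUnion_compl_inter_iUnion (𝒮 : Set ↥(Comps G X)) :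
    ((⋃ C ∈ 𝒮ᶜ, (C : Set V)) ∪ X) ∩ ((⋃ C ∈ 𝒮, (C : Set V)) ∪ X) = X := by
  apply Subset.antisymm
  · rintro v ⟨h₁, h₂⟩
    by_contra hvX
    obtain ⟨C, hC, hvC⟩ := Comps.exists_mem G hvX
    exact (mem_iUnion_comps_iff ⟨C, hC⟩ hvC).1 h₁ ((mem_iUnion_comps_iff ⟨C, hC⟩ hvC).1 h₂)
  · exact fun v hv => ⟨Or.inr hv, Or.inr hv⟩

theorem isFinSep_iUnion (hX : X.Finite) (𝒮 : Set ↥(Comps G X)) :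
    IsFinSep G ((⋃ C ∈ 𝒮ᶜ, (C : Set V)) ∪ X) ((⋃ C ∈ 𝒮, (C : Set V)) ∪ X) := by
  refine ⟨⟨eq_univ_of_forall fun v => ?_, ?_⟩, by rwa [iUnion_compl_inter_iUnion]⟩
  · by_cases hvX : v ∈ X
    · exact Or.inl (Or.inr hvX)
    · obtain ⟨C, hC, hvC⟩ := Comps.exists_mem G hvX
      by_cases h : (⟨C, hC⟩ : ↥(Comps G X)) ∈ 𝒮
      · exact Or.inr ((mem_iUnion_comps_iff ⟨C, hC⟩ hvC).2 h)
      · exact Or.inl ((mem_iUnion_comps_iff ⟨C, hC⟩ hvC).2 h)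
  · rintro a ⟨-, ha⟩ b ⟨hb, hb'⟩ hab
    have haX : a ∉ X := fun h => ha (Or.inr h)
    obtain ⟨C, hC, hbC⟩ := mem_iUnion₂.1 (hb.resolve_right fun h => hb' (Or.inr h))
    exact ha (Or.inl (mem_iUnion₂.2 ⟨C, hC, Comps.mem_of_adj C.2 hbC haX hab.symm⟩))

end Sides

/-- The orientation of the finite-order separations of `G` induced by a family of collections
of sets of components. -/
def familyOrientation (G : SimpleGraph V) (Us : (X : Set V) → Set (Set ↥(Comps G X))) :
    Set (Set V × Set V) :=
  {p | IsFinSep G p.1 p.2 ∧ compsWithin G (p.1 ∩ p.2) p.2 ∈ Us (p.1 ∩ p.2)}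

section Family

variable {G : SimpleGraph V} {Us : (X : Set V) → Set (Set ↥(Comps G X))}

theorem IsUltra.compl_mem_iff {α : Type*} {F : Set (Set α)} (hF : IsUltra F) (s : Set α) :
    sᶜ ∈ F ↔ s ∉ F := by
  refine ⟨fun h hs => hF.1 ?_, fun h => (hF.2.2.2 s).resolve_left h⟩
  simpa using hF.2.1 s hs _ h

theorem IsUltra.biInter_mem {α ι : Type*} {F : Set (Set α)} (hF : IsUltra F) {I : Set ι}
    (hI : I.Finite) {s : ι → Set α} (hs : ∀ i ∈ I, s i ∈ F) : ⋂ i ∈ I, s i ∈ F := by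
  induction I, hI using Set.Finite.induction_on with
  | empty =>
    have := (hF.compl_mem_iff ∅).2 hF.1
    simpa using this
  | insert _ _ ih =>
    rw [biInter_insert]
    exact hF.2.1 _ (hs _ (mem_insert _ _)) _ (ih fun i hi => hs i (mem_insert_of_mem _ hi))

/-- Membership in the induced orientation can be tested at any finite superset of the
separator. -/
theorem compsWithin_mem_iff
    (hcomp : ∀ X X' : Set V, X.Finite → X'.Finite → X ⊆ X' → pushUF G X X' (Us X') = Us X)
    {A B X : Set V} (h : IsFinSep G A B) (hX : X.Finite) (hABX : A ∩ B ⊆ X) :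
    compsWithin G (A ∩ B) B ∈ Us (A ∩ B) ↔ compsWithin G X B ∈ Us X := by
  rw [← hcomp _ X h.2 hX hABX]
  have hpre : {C' : ↥(Comps G X) | ∃ C ∈ compsWithin G (A ∩ B) B, (C' : Set V) ⊆ (C : Set V)} =
      compsWithin G X B := by
    ext C'
    constructor
    · rintro ⟨C, hC, hCC⟩
      exact hCC.trans hC
    · intro hC'
      obtain ⟨v, hv⟩ := Comps.nonempty C'.2
      obtain ⟨C, hC, hvC⟩ := Comps.exists_mem G fun h => Comps.notMem C'.2 hv (hABX h)
      exact ⟨⟨C, hC⟩, h.comp_subset subset_rfl hC hvC (hC' hv),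
        Comps.subset_of_mem hABX hC C'.2 hvC hv⟩
  change {C' : ↥(Comps G X) | ∃ C ∈ compsWithin G (A ∩ B) B, (C' : Set V) ⊆ (C : Set V)} ∈ Us X ↔ _
  rw [hpre]

/-- The target sides of finitely many members of the induced orientation have infinite
intersection. -/
theorem infinite_biInter_of_subset_familyOrientation
    (hUs : ∀ X : Set V, X.Finite → IsUltra (Us X))
    (hcomp : ∀ X X' : Set V, X.Finite → X'.Finite → X ⊆ X' → pushUF G X X' (Us X') = Us X)
    {σ : Set (Set V × Set V)} (hσ : σ ⊆ familyOrientation G Us) (hfin : σ.Finite) :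
    (⋂ p ∈ σ, p.2).Infinite := by
  intro hinter
  set X : Set V := (⋃ p ∈ σ, p.1 ∩ p.2) ∪ ⋂ p ∈ σ, p.2
  have hX : X.Finite := (hfin.biUnion fun p hp => (hσ hp).1.2).union hinter
  have hmem : ∀ p ∈ σ, compsWithin G X p.2 ∈ Us X := fun p hp =>
    (compsWithin_mem_iff hcomp (hσ hp).1 hX
      ((subset_biUnion_of_mem (u := fun p : Set V × Set V => p.1 ∩ p.2) hp).trans
        subset_union_left)).1 (hσ hp).2
  have hempty : ⋂ p ∈ σ, compsWithin G X p.2 = ∅ := by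
    refine eq_empty_of_forall_notMem fun C hC => ?_
    obtain ⟨v, hv⟩ := Comps.nonempty C.2
    exact Comps.notMem C.2 hv (Or.inr (mem_iInter₂.2 fun p hp => mem_iInter₂.1 hC p hp hv))
  exact (hUs X hX).1 (hempty ▸ (hUs X hX).biInter_mem hfin hmem)

theorem isTangle_familyOrientation
    (hUs : ∀ X : Set V, X.Finite → IsUltra (Us X))
    (hcomp : ∀ X X' : Set V, X.Finite → X'.Finite → X ⊆ X' → pushUF G X X' (Us X') = Us X) :
    IsTangle G (familyOrientation G Us) := by
  refine ⟨⟨fun p hp => hp.1, fun A B h => ?_⟩, ?_, fun σ hσ hT =>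
    infinite_biInter_of_subset_familyOrientation hUs hcomp hσ hT.2.1 hT.2.2.2⟩
  · have hBA : (B, A) ∈ familyOrientation G Us ↔ compsWithin G (A ∩ B) A ∈ Us (A ∩ B) := by
      rw [← compsWithin_mem_iff hcomp h.symm h.2 (inter_comm B A).subset]
      exact and_iff_right h.symm
    rw [hBA, h.compsWithin_left subset_rfl, (hUs _ h.2).compl_mem_iff, not_not]
    exact and_iff_right h
  · rintro A B C D hBA hCD - ⟨⟨hAC, -⟩, -⟩
    refine infinite_biInter_of_subset_familyOrientation hUs hcomp (σ := {(B, A), (C, D)})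
      (insert_subset hBA (singleton_subset_iff.2 hCD)) (toFinite _) ?_
    rw [biInter_pair]
    exact hCD.1.2.subset (inter_subset_inter_left _ hAC)

theorem tangleUF_familyOrientation {X : Set V} (hX : X.Finite) :
    tangleUF G (familyOrientation G Us) X = Us X := by
  ext 𝒮
  refine (and_iff_right (isFinSep_iUnion hX 𝒮)).trans ?_
  dsimp only
  rw [iUnion_compl_inter_iUnion, compsWithin_iUnion]

theorem IsFinSep.mem_iff_compsWithin_mem_tangleUF {A B : Set V} (h : IsFinSep G A B)
    (τ : Set (Set V × Set V)) :
    (A, B) ∈ τ ↔ compsWithin G (A ∩ B) B ∈ tangleUF G τ (A ∩ B) := by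
  rw [tangleUF, mem_ofPred_eq, h.iUnion_compsWithin, h.iUnion_compl_compsWithin]

end Family

/-- Lemma 2.3: every compatible family of ultrafilters of cofinite
components comes from a unique `ℵ₀`-tangle; hence `τ ↦ (U(τ,X))_X` is a bijection onto
the inverse limit. -/
theorem stmt9 [Infinite V] (G : SimpleGraph V)
    (Us : (X : Set V) → Set (Set ↥(Comps G X)))
    (hUs : ∀ X : Set V, X.Finite → IsUltra (Us X))
    (hcomp : ∀ X X' : Set V, X.Finite → X'.Finite → X ⊆ X' →
        pushUF G X X' (Us X') = Us X) :
    ∃! τ : Set (Set V × Set V), IsTangle G τ ∧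
      ∀ X : Set V, X.Finite → tangleUF G τ X = Us X := by
  refine ⟨familyOrientation G Us, ⟨isTangle_familyOrientation hUs hcomp,
    fun X hX => tangleUF_familyOrientation hX⟩, ?_⟩
  rintro τ ⟨hτ, hτU⟩
  ext ⟨A, B⟩
  by_cases h : IsFinSep G A B
  · rw [h.mem_iff_compsWithin_mem_tangleUF, hτU _ h.2]
    exact (and_iff_right h).symm
  · exact ⟨fun hAB => absurd (hτ.1.1 hAB) h, fun hAB => absurd hAB.1 h⟩
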